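/- The polytope P = conv{(0,0,0),(1,0,0),(0,1,0),(1,1,0),(-1,0,1),(1,1,1),(0,1,-1),(2,0,-1)} admits no unimodular triangulation, i.e., no triangulation of P using only its vertices in which all tetrahedra have volume 1/6. -/

import Mathlib

open Set MeasureTheory
open scoped Classical

noncomputable section

abbrev Pt3 := Fin 3 → ℝ

/-- A (geometric) tetrahedron: 4 affinely independent points. -/
def IsTet (σ : Finset Pt3) : Prop :=
  σ.card = 4 ∧ AffineIndependent ℝ (fun p : (σ : Set Pt3) => (p : Pt3))

/-- A dissection of the convex polytope `conv V` using only vertices in `V`: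
tetrahedra with pairwise disjoint interiors covering the polytope. -/
def IsDissection (V : Finset Pt3) (D : Finset (Finset Pt3)) : Prop :=
  (∀ σ ∈ D, IsTet σ ∧ (σ : Set Pt3) ⊆ (V : Set Pt3)) ∧
  (∀ σ ∈ D, ∀ τ ∈ D, σ ≠ τ →
    interior (convexHull ℝ (σ : Set Pt3)) ∩ interior (convexHull ℝ (τ : Set Pt3)) = ∅) ∧
  (⋃ σ ∈ D, convexHull ℝ (σ : Set Pt3)) = convexHull ℝ (V : Set Pt3)

/-- A triangulation: a dissection in which any two tetrahedra meet in a common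
(possibly empty) face. -/
def IsTriangulation (V : Finset Pt3) (D : Finset (Finset Pt3)) : Prop :=
  IsDissection V D ∧
  ∀ σ ∈ D, ∀ τ ∈ D,
    convexHull ℝ (σ : Set Pt3) ∩ convexHull ℝ (τ : Set Pt3)
      = convexHull ℝ ((σ ∩ τ : Finset Pt3) : Set Pt3)

/-- The eight vertices `s, e, w, n, v₁, v₂, u₁, u₂` of the polytope `P` of
Proposition 2.2(1). -/
def Pverts : Finset Pt3 :=
  {![0, 0, 0], ![1, 0, 0], ![0, 1, 0], ![1, 1, 0],
   ![-1, 0, 1], ![1, 1, 1], ![0, 1, -1], ![2, 0, -1]}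

open scoped ENNReal

/-- The (signed, normalized) volume of a tetrahedron. -/
def tetDet {R : Type} [CommRing R] (a b c d : Fin 3 → R) : R :=
  (b 0 - a 0) * ((c 1 - a 1) * (d 2 - a 2) - (c 2 - a 2) * (d 1 - a 1))
  - (b 1 - a 1) * ((c 0 - a 0) * (d 2 - a 2) - (c 2 - a 2) * (d 0 - a 0))
  + (b 2 - a 2) * ((c 0 - a 0) * (d 1 - a 1) - (c 1 - a 1) * (d 0 - a 0))

/-- Integer vertices. -/
def vz : Fin 8 → Fin 3 → ℤ :=
  ![![0, 0, 0], ![1, 0, 0], ![0, 1, 0], ![1, 1, 0],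
    ![-1, 0, 1], ![1, 1, 1], ![0, 1, -1], ![2, 0, -1]]

/-- Real vertices. -/
def vr (i : Fin 8) : Pt3 := fun k => (vz i k : ℝ)

def stdTet : Set Pt3 := convexHull ℝ {![0, 0, 0], ![1, 0, 0], ![0, 1, 0], ![0, 0, 1]}

lemma mem_hull4 {a b c d p : Pt3} (h : p ∈ convexHull ℝ ({a, b, c, d} : Set Pt3)) :
    ∃ w x y z : ℝ, 0 ≤ w ∧ 0 ≤ x ∧ 0 ≤ y ∧ 0 ≤ z ∧ w + x + y + z = 1 ∧
      ∀ k, p k = w * a k + x * b k + y * c k + z * d k := by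
  rw [convexHull_insert (by simp), convexHull_insert (by simp), convexHull_pair] at h
  simp only [mem_convexJoin, mem_singleton_iff, exists_eq_left] at h
  obtain ⟨q, ⟨r, hr, hq⟩, hp⟩ := h
  obtain ⟨s1, t1, h1, h1', e1, rfl⟩ := hr
  obtain ⟨s2, t2, h2, h2', e2, rfl⟩ := hq
  obtain ⟨s3, t3, h3, h3', e3, rfl⟩ := hp
  refine ⟨s3, t3 * s2, t3 * t2 * s1, t3 * t2 * t1, by positivity, by positivity, by positivity,
    by positivity, ?_, ?_⟩
  · linear_combination e3 + t3 * e2 + t3 * t2 * e1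
  · intro k
    simp only [Pi.add_apply, Pi.smul_apply, smul_eq_mul]
    ring

lemma hull4_mem {a b c d p : Pt3} (w x y z : ℝ) (hw : 0 ≤ w) (hx : 0 ≤ x) (hy : 0 ≤ y)
    (hz : 0 ≤ z) (h1 : w + x + y + z = 1)
    (hp : ∀ k, p k = w * a k + x * b k + y * c k + z * d k) {S : Set Pt3}
    (ha : a ∈ S) (hb : b ∈ S) (hc : c ∈ S) (hd : d ∈ S) :
    p ∈ convexHull ℝ S := by
  have hconv := convex_convexHull ℝ S
  have key := hconv.sum_mem (t := Finset.univ) (w := ![w, x, y, z]) (z := ![a, b, c, d])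
    (by intro i _; fin_cases i <;> simpa)
    (by simpa [Fin.sum_univ_four] using h1)
    (by intro i _; fin_cases i <;> simp <;> exact subset_convexHull ℝ S ‹_›)
  convert key
  ext k
  rw [hp k]
  simp [Fin.sum_univ_four]

lemma volume_hull4 (a b c d : Pt3) :
    volume (convexHull ℝ ({a, b, c, d} : Set Pt3))
      = ENNReal.ofReal |tetDet a b c d| * volume stdTet := by
  let M : Matrix (Fin 3) (Fin 3) ℝ :=
    Matrix.of fun i j => (![b, c, d] j) i - a i
  have hdet : LinearMap.det (Matrix.toLin' M) = tetDet a b c d := by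
    rw [LinearMap.det_toLin', Matrix.det_fin_three]
    simp [M, tetDet]
    ring
  have himg : convexHull ℝ ({a, b, c, d} : Set Pt3)
      = (fun x => a + x) '' (Matrix.toLin' M '' stdTet) := by
    have h0 : ({a, b, c, d} : Set Pt3) = (fun x => a + x) '' (Matrix.toLin' M ''
        {![0, 0, 0], ![1, 0, 0], ![0, 1, 0], ![0, 0, 1]}) := by
      simp only [image_insert_eq, image_singleton]
      congr 1
      · ext k; simp [Matrix.toLin'_apply, Matrix.mulVec_eq_sum, Fin.sum_univ_three, M]
      congr 1
      · ext k; simp [Matrix.toLin'_apply, Matrix.mulVec_eq_sum, Fin.sum_univ_three, M]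
      congr 1
      · ext k; simp [Matrix.toLin'_apply, Matrix.mulVec_eq_sum, Fin.sum_univ_three, M]
      congr 1
      · ext k; simp [Matrix.toLin'_apply, Matrix.mulVec_eq_sum, Fin.sum_univ_three, M]
    rw [h0, stdTet, LinearMap.image_convexHull]
    have := (convexHull_vadd (𝕜 := ℝ) a (Matrix.toLin' M ''
        {![0, 0, 0], ![1, 0, 0], ![0, 1, 0], ![0, 0, 1]}))
    simpa [← image_vadd] using this
  rw [himg, image_add_left, measure_preimage_add, Measure.addHaar_image_linearMap, hdet]

lemma cube_sub_aux (x : Pt3) (i j k : Fin 3) (a b c d : Pt3)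
    (hx : x ∈ Icc (0 : Pt3) 1) (h1 : x j ≤ x i) (h2 : x k ≤ x j)
    (he : ∀ m, x m = (1 - x i) * a m + (x i - x j) * b m + (x j - x k) * c m + x k * d m) :
    x ∈ convexHull ℝ ({a, b, c, d} : Set Pt3) := by
  have e1 := hx.2 i
  have e2 := hx.1 k
  simp at e1 e2
  exact hull4_mem (1 - x i) (x i - x j) (x j - x k) (x k) (by linarith) (by linarith)
    (by linarith) e2 (by ring) he (by simp) (by simp) (by simp) (by simp)

lemma one_le_std : 1 ≤ 6 * volume stdTet := by
  have hv (b c : Pt3) (h : |tetDet (R := ℝ) ![0, 0, 0] b c ![1, 1, 1]| = 1) :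
      volume (convexHull ℝ ({![0, 0, 0], b, c, ![1, 1, 1]} : Set Pt3)) = volume stdTet := by
    rw [volume_hull4, h]; simp
  have h1 := hv ![1, 0, 0] ![1, 1, 0] (by simp [tetDet])
  have h2 := hv ![1, 0, 0] ![1, 0, 1] (by simp [tetDet])
  have h3 := hv ![0, 1, 0] ![1, 1, 0] (by simp [tetDet])
  have h4 := hv ![0, 1, 0] ![0, 1, 1] (by simp [tetDet])
  have h5 := hv ![0, 0, 1] ![1, 0, 1] (by simp [tetDet])
  have h6 := hv ![0, 0, 1] ![0, 1, 1] (by simp [tetDet])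
  have hc : volume (Icc (0 : Pt3) 1) = 1 := by
    rw [Real.volume_Icc_pi]; simp
  rw [← hc]
  have hsub : Icc (0 : Pt3) 1 ⊆
      convexHull ℝ ({![0, 0, 0], ![1, 0, 0], ![1, 1, 0], ![1, 1, 1]} : Set Pt3) ∪
      (convexHull ℝ ({![0, 0, 0], ![1, 0, 0], ![1, 0, 1], ![1, 1, 1]} : Set Pt3) ∪
      (convexHull ℝ ({![0, 0, 0], ![0, 1, 0], ![1, 1, 0], ![1, 1, 1]} : Set Pt3) ∪
      (convexHull ℝ ({![0, 0, 0], ![0, 1, 0], ![0, 1, 1], ![1, 1, 1]} : Set Pt3) ∪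
      (convexHull ℝ ({![0, 0, 0], ![0, 0, 1], ![1, 0, 1], ![1, 1, 1]} : Set Pt3) ∪
      convexHull ℝ ({![0, 0, 0], ![0, 0, 1], ![0, 1, 1], ![1, 1, 1]} : Set Pt3))))) := by
    intro x hx
    simp only [mem_union]
    rcases le_total (x 0) (x 1) with h01 | h01 <;> rcases le_total (x 1) (x 2) with h12 | h12 <;>
      rcases le_total (x 0) (x 2) with h02 | h02
    · exact .inr (.inr (.inr (.inr (.inr (cube_sub_aux x 2 1 0 _ _ _ _ hx h12 h01
        (by intro m; fin_cases m <;> simp))))))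
    · exact .inr (.inr (.inr (.inr (.inr (cube_sub_aux x 2 1 0 _ _ _ _ hx h12 h01
        (by intro m; fin_cases m <;> simp))))))
    · exact .inr (.inr (.inr (.inl (cube_sub_aux x 1 2 0 _ _ _ _ hx h12 h02
        (by intro m; fin_cases m <;> simp)))))
    · exact .inr (.inr (.inl (cube_sub_aux x 1 0 2 _ _ _ _ hx h01 h02
        (by intro m; fin_cases m <;> simp))))
    · exact .inr (.inr (.inr (.inr (.inl (cube_sub_aux x 2 0 1 _ _ _ _ hx h02 h01
        (by intro m; fin_cases m <;> simp))))))
    · exact .inr (.inl (cube_sub_aux x 0 2 1 _ _ _ _ hx h02 h12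
        (by intro m; fin_cases m <;> simp)))
    · exact .inl (cube_sub_aux x 0 1 2 _ _ _ _ hx h01 h12
        (by intro m; fin_cases m <;> simp))
    · exact .inl (cube_sub_aux x 0 1 2 _ _ _ _ hx h01 h12
        (by intro m; fin_cases m <;> simp))
  refine (measure_mono hsub).trans ?_
  refine (measure_union_le _ _).trans ((add_le_add le_rfl ((measure_union_le _ _).trans
    (add_le_add le_rfl ((measure_union_le _ _).trans (add_le_add le_rfl
    ((measure_union_le _ _).trans (add_le_add le_rfl (measure_union_le _ _)))))))).trans ?_)
  rw [h1, h2, h3, h4, h5, h6]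
  apply le_of_eq
  ring

/-- A tetrahedron on integer points with volume `1/6` has determinant `±1`. -/
lemma natAbs_eq_one {a b c d : Pt3} {D : ℤ} (hD : tetDet a b c d = (D : ℝ))
    (h : volume (convexHull ℝ ({a, b, c, d} : Set Pt3)) = (6 : ℝ≥0∞)⁻¹) :
    D.natAbs = 1 := by
  rw [volume_hull4, hD] at h
  have hn : ENNReal.ofReal |(D : ℝ)| = (D.natAbs : ℝ≥0∞) := by
    rw [← Int.cast_abs, Int.abs_eq_natAbs, Int.cast_natCast, ENNReal.ofReal_natCast]
  rw [hn] at h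
  have h6 : (6 : ℝ≥0∞) * ((D.natAbs : ℝ≥0∞) * volume stdTet) = 1 := by
    rw [h]; exact ENNReal.mul_inv_cancel (by simp) (by simp)
  have hle : (D.natAbs : ℝ≥0∞) ≤ 1 := by
    calc (D.natAbs : ℝ≥0∞) = D.natAbs * 1 := by simp
      _ ≤ D.natAbs * (6 * volume stdTet) := by gcongr; exact one_le_std
      _ = 1 := by rw [← h6]; ring
  have hle' : D.natAbs ≤ 1 := by exact_mod_cast hle
  have hne : D.natAbs ≠ 0 := by
    intro h0
    rw [h0] at h6
    simp at h6
  omega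

/-- Signs of barycentric coordinates. -/
lemma bary_nonneg {a b c d p : Pt3} (h : p ∈ convexHull ℝ ({a, b, c, d} : Set Pt3)) :
    0 ≤ tetDet p b c d * tetDet a b c d ∧ 0 ≤ tetDet a p c d * tetDet a b c d ∧
    0 ≤ tetDet a b p d * tetDet a b c d ∧ 0 ≤ tetDet a b c p * tetDet a b c d := by
  obtain ⟨w, x, y, z, hw, hx, hy, hz, h1, hp⟩ := mem_hull4 h
  obtain rfl : w = 1 - x - y - z := by linarith
  have k1 : tetDet p b c d = (1 - x - y - z) * tetDet a b c d := by
    simp only [tetDet, hp]; ring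
  have k2 : tetDet a p c d = x * tetDet a b c d := by
    simp only [tetDet, hp]; ring
  have k3 : tetDet a b p d = y * tetDet a b c d := by
    simp only [tetDet, hp]; ring
  have k4 : tetDet a b c p = z * tetDet a b c d := by
    simp only [tetDet, hp]; ring
  rw [k1, k2, k3, k4]
  refine ⟨?_, ?_, ?_, ?_⟩ <;> rw [mul_assoc] <;>
    exact mul_nonneg ‹_› (mul_self_nonneg _)

/-- The integer test: unimodular, and the point `q / 4` lies in the closed tetrahedron. -/
def passes (q : Fin 3 → ℤ) (a b c d : Fin 3 → ℤ) : Prop :=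
  (tetDet a b c d).natAbs = 1 ∧
  0 ≤ tetDet q (4 * b) (4 * c) (4 * d) * tetDet a b c d ∧
  0 ≤ tetDet (4 * a) q (4 * c) (4 * d) * tetDet a b c d ∧
  0 ≤ tetDet (4 * a) (4 * b) q (4 * d) * tetDet a b c d ∧
  0 ≤ tetDet (4 * a) (4 * b) (4 * c) q * tetDet a b c d

def decPasses (q a b c d : Fin 3 → ℤ) : Decidable (passes q a b c d) := by
  unfold passes
  exact @instDecidableAnd _ _ (instDecidableEqNat _ _) (@instDecidableAnd _ _ (Int.decLe _ _)
    (@instDecidableAnd _ _ (Int.decLe _ _) (@instDecidableAnd _ _ (Int.decLe _ _)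
    (Int.decLe _ _))))

lemma passes_p (i j k l : Fin 8) (hij : i < j) (hjk : j < k) (hkl : k < l)
    (h : passes ![1, 2, 2] (vz i) (vz j) (vz k) (vz l)) : i = 0 ∧ j = 3 ∧ k = 4 ∧ l = 5 := by
  have key : ∀ i j k l : Fin 8, (!(Nat.blt i j && (Nat.blt j k && (Nat.blt k l &&
      @decide _ (decPasses ![1, 2, 2] (vz i) (vz j) (vz k) (vz l))))) ||
      (Nat.beq i 0 && (Nat.beq j 3 && (Nat.beq k 4 && Nat.beq l 5)))) = true := by
    decide +kernel
  have h1 := key i j k l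
  rw [Fin.lt_def, ← Nat.blt_eq] at hij hjk hkl
  rw [hij, hjk, hkl, @decide_eq_true _ (decPasses _ _ _ _ _) h] at h1
  simp only [Bool.and_self, Bool.not_true, Bool.false_or, Bool.and_eq_true, Nat.beq_eq] at h1
  exact ⟨Fin.ext h1.1, Fin.ext h1.2.1, Fin.ext h1.2.2.1, Fin.ext h1.2.2.2⟩

lemma passes_q (i j k l : Fin 8) (hij : i < j) (hjk : j < k) (hkl : k < l)
    (h : passes ![3, 2, -2] (vz i) (vz j) (vz k) (vz l)) : i = 1 ∧ j = 2 ∧ k = 6 ∧ l = 7 := by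
  have key : ∀ i j k l : Fin 8, (!(Nat.blt i j && (Nat.blt j k && (Nat.blt k l &&
      @decide _ (decPasses ![3, 2, -2] (vz i) (vz j) (vz k) (vz l))))) ||
      (Nat.beq i 1 && (Nat.beq j 2 && (Nat.beq k 6 && Nat.beq l 7)))) = true := by
    decide +kernel
  have h1 := key i j k l
  rw [Fin.lt_def, ← Nat.blt_eq] at hij hjk hkl
  rw [hij, hjk, hkl, @decide_eq_true _ (decPasses _ _ _ _ _) h] at h1
  simp only [Bool.and_self, Bool.not_true, Bool.false_or, Bool.and_eq_true, Nat.beq_eq] at h1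
  exact ⟨Fin.ext h1.1, Fin.ext h1.2.1, Fin.ext h1.2.2.1, Fin.ext h1.2.2.2⟩

lemma passes_of_mem (q : Fin 3 → ℤ) (i j k l : Fin 8)
    (hv : volume (convexHull ℝ ({vr i, vr j, vr k, vr l} : Set Pt3)) = (6 : ℝ≥0∞)⁻¹)
    (hm : (fun m => (q m : ℝ) / 4) ∈ convexHull ℝ ({vr i, vr j, vr k, vr l} : Set Pt3)) :
    passes q (vz i) (vz j) (vz k) (vz l) := by
  have hD : tetDet (vr i) (vr j) (vr k) (vr l)
      = ((tetDet (vz i) (vz j) (vz k) (vz l) : ℤ) : ℝ) := by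
    simp only [tetDet, vr]; push_cast; ring
  obtain ⟨h1, h2, h3, h4⟩ := bary_nonneg hm
  rw [hD] at h1 h2 h3 h4
  refine ⟨natAbs_eq_one hD hv, ?_, ?_, ?_, ?_⟩ <;> rw [← Int.cast_nonneg_iff (R := ℝ), Int.cast_mul]
  · refine (mul_nonneg (by norm_num : (0 : ℝ) ≤ 64) h1).trans_eq ?_
    rw [← mul_assoc]; congr 1
    simp only [tetDet, vr, Pi.mul_apply, Pi.ofNat_apply]; push_cast; ring
  · refine (mul_nonneg (by norm_num : (0 : ℝ) ≤ 64) h2).trans_eq ?_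
    rw [← mul_assoc]; congr 1
    simp only [tetDet, vr, Pi.mul_apply, Pi.ofNat_apply]; push_cast; ring
  · refine (mul_nonneg (by norm_num : (0 : ℝ) ≤ 64) h3).trans_eq ?_
    rw [← mul_assoc]; congr 1
    simp only [tetDet, vr, Pi.mul_apply, Pi.ofNat_apply]; push_cast; ring
  · refine (mul_nonneg (by norm_num : (0 : ℝ) ≤ 64) h4).trans_eq ?_
    rw [← mul_assoc]; congr 1
    simp only [tetDet, vr, Pi.mul_apply, Pi.ofNat_apply]; push_cast; ring

lemma vz_inj : Function.Injective vz := by decide +kernel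

lemma vr_inj : Function.Injective vr := by
  intro i j h
  apply vz_inj
  ext k
  have := congrFun h k
  simpa [vr] using this

lemma Pverts_eq : Pverts = Finset.univ.image vr := by
  have h (i : Fin 8) (x : Pt3) (hx : ∀ k, x k = (vz i k : ℝ)) : vr i = x := by
    ext k; simp [vr, hx]
  have hu : (Finset.univ : Finset (Fin 8)) = {0, 1, 2, 3, 4, 5, 6, 7} := by decide
  rw [hu]
  simp only [Finset.image_insert, Finset.image_singleton]
  rw [h 0 ![0, 0, 0], h 1 ![1, 0, 0], h 2 ![0, 1, 0], h 3 ![1, 1, 0], h 4 ![-1, 0, 1],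
    h 5 ![1, 1, 1], h 6 ![0, 1, -1], h 7 ![2, 0, -1], Pverts]
  all_goals intro k; fin_cases k <;> simp [vz]

lemma exists_tuple {σ : Finset Pt3} (hc : σ.card = 4) (hs : (σ : Set Pt3) ⊆ Pverts) :
    ∃ i j k l : Fin 8, i < j ∧ j < k ∧ k < l ∧ (σ : Set Pt3) = {vr i, vr j, vr k, vr l} := by
  rw [Finset.coe_subset, Pverts_eq] at hs
  obtain ⟨I, -, rfl⟩ := Finset.subset_image_iff.1 hs
  rw [Finset.card_image_of_injective _ vr_inj] at hc
  have hr := Finset.range_orderEmbOfFin I hc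
  let f := I.orderEmbOfFin hc
  refine ⟨f 0, f 1, f 2, f 3, f.strictMono (by decide), f.strictMono (by decide),
    f.strictMono (by decide), ?_⟩
  rw [Finset.coe_image, ← hr, ← range_comp]
  ext x
  simp only [mem_range, Function.comp_apply, mem_insert_iff, mem_singleton_iff]
  constructor
  · rintro ⟨y, rfl⟩
    fin_cases y <;> simp [f]
  · rintro (rfl | rfl | rfl | rfl)
    · exact ⟨0, rfl⟩
    · exact ⟨1, rfl⟩
    · exact ⟨2, rfl⟩
    · exact ⟨3, rfl⟩

/-- In a unimodular triangulation, a point of `P` forces a tetrahedron passing the test. -/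
lemma forced {T : Finset (Finset Pt3)} (hT : IsDissection Pverts T)
    (hu : ∀ σ ∈ T, volume (convexHull ℝ (σ : Set Pt3)) = (6 : ℝ≥0∞)⁻¹) (q : Fin 3 → ℤ)
    (hq : (fun m => (q m : ℝ) / 4) ∈ convexHull ℝ (Pverts : Set Pt3)) :
    ∃ σ ∈ T, ∃ i j k l : Fin 8, i < j ∧ j < k ∧ k < l ∧
      (σ : Set Pt3) = {vr i, vr j, vr k, vr l} ∧ passes q (vz i) (vz j) (vz k) (vz l) := by
  obtain ⟨h1, -, h3⟩ := hT
  rw [← h3] at hq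
  simp only [mem_iUnion] at hq
  obtain ⟨σ, hσ, hm⟩ := hq
  obtain ⟨i, j, k, l, hij, hjk, hkl, e⟩ := exists_tuple (h1 σ hσ).1.1 (h1 σ hσ).2
  have hv := hu σ hσ
  rw [e] at hm hv
  exact ⟨σ, hσ, i, j, k, l, hij, hjk, hkl, e, passes_of_mem q i j k l hv hm⟩

lemma vr_mem (i : Fin 8) : vr i ∈ (Pverts : Set Pt3) := by
  rw [Pverts_eq]; simp

/-- The polytope `P` admits no unimodular triangulation: no
triangulation of `P` using only its vertices has all tetrahedra of volume `1/6`. -/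
theorem Pverts_no_unimodular_triangulation :
    ¬ ∃ T : Finset (Finset Pt3), IsTriangulation Pverts T ∧
      ∀ σ ∈ T, volume (convexHull ℝ (σ : Set Pt3)) = (6 : ℝ≥0∞)⁻¹ := by
  rintro ⟨T, ⟨hD, hF⟩, hu⟩
  obtain ⟨σ, hσ, i, j, k, l, hij, hjk, hkl, eσ, hp⟩ := forced hD hu ![1, 2, 2]
    (hull4_mem (1/4) (1/4) (1/4) (1/4) (by norm_num) (by norm_num) (by norm_num) (by norm_num)
      (by norm_num) (by intro m; fin_cases m <;> simp [vr, vz] <;> norm_num)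
      (vr_mem 0) (vr_mem 3) (vr_mem 4) (vr_mem 5))
  obtain ⟨rfl, rfl, rfl, rfl⟩ := passes_p i j k l hij hjk hkl hp
  obtain ⟨τ, hτ, i, j, k, l, hij, hjk, hkl, eτ, hq⟩ := forced hD hu ![3, 2, -2]
    (hull4_mem (1/4) (1/4) (1/4) (1/4) (by norm_num) (by norm_num) (by norm_num) (by norm_num)
      (by norm_num) (by intro m; fin_cases m <;> simp [vr, vz] <;> norm_num)
      (vr_mem 1) (vr_mem 2) (vr_mem 6) (vr_mem 7))
  obtain ⟨rfl, rfl, rfl, rfl⟩ := passes_q i j k l hij hjk hkl hq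
  have c1 : ![1/2, 1/2, 0] ∈ convexHull ℝ (σ : Set Pt3) := by
    rw [eσ]
    exact hull4_mem (a := vr 0) (b := vr 3) (c := vr 4) (d := vr 5) (1/2) (1/2) 0 0
      (by norm_num) (by norm_num) le_rfl le_rfl (by norm_num)
      (by intro m; fin_cases m <;> simp [vr, vz]) (by simp) (by simp) (by simp) (by simp)
  have c2 : ![1/2, 1/2, 0] ∈ convexHull ℝ (τ : Set Pt3) := by
    rw [eτ]
    exact hull4_mem (a := vr 1) (b := vr 2) (c := vr 6) (d := vr 7) (1/2) (1/2) 0 0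
      (by norm_num) (by norm_num) le_rfl le_rfl (by norm_num)
      (by intro m; fin_cases m <;> simp [vr, vz]) (by simp) (by simp) (by simp) (by simp)
  have c3 : ![1/2, 1/2, 0] ∈ convexHull ℝ ((σ ∩ τ : Finset Pt3) : Set Pt3) := by
    rw [← hF σ hσ τ hτ]; exact ⟨c1, c2⟩
  obtain ⟨x, hx⟩ := convexHull_nonempty_iff.1 ⟨_, c3⟩
  rw [Finset.coe_inter, eσ, eτ] at hx
  obtain ⟨hx1, hx2⟩ := hx
  simp only [mem_insert_iff, mem_singleton_iff] at hx1 hx2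
  rcases hx1 with rfl | rfl | rfl | rfl <;> simp [vr_inj.eq_iff] at hx2
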